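/- Consider the Polya urn with initially one white and one black ball, one ball added at each step, and let X_n be the proportion of white balls after n drawings, satisfying X_{n+1} = X_n + (1/(n+3))(1_{U_{n+1} ≤ X_n} − X_n) with U_{n+1} uniform on [0,1] independent of F_n = σ(X_0,…,X_n). Let X = lim X_n (a.s. limit of the bounded martingale). Then E[(X − X_n)²] = ∑_{k=n}^∞ E[X_k(1−X_k)]/(k+3)² and n·E[(X−X_n)²] → 1/6 as n → ∞. -/

import Mathlib

open MeasureTheory ProbabilityTheory Filter

theorem key_aux {Ω : Type*} [m0 : MeasurableSpace Ω]
    (P : Measure Ω) [IsProbabilityMeasure P] (V Y Z : Ω → ℝ)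
    (hV : Measurable V) (hY : Measurable Y) (hZ : Measurable Z)
    (hY0 : ∀ ω, 0 ≤ Y ω) (hY1 : ∀ ω, Y ω ≤ 1) (hZb : ∀ ω, |Z ω| ≤ 1)
    (hunif : P.map V = volume.restrict (Set.Icc (0:ℝ) 1))
    (hind : IndepFun (fun ω => (Y ω, Z ω)) V P) :
    ∫ ω, Z ω * (if V ω ≤ Y ω then (1:ℝ) else 0) ∂P = ∫ ω, Z ω * Y ω ∂P := by
  have hYZ : Measurable (fun ω => (Y ω, Z ω)) := hY.prodMk hZ
  have hmap := (indepFun_iff_map_prod_eq_prod_map_map hYZ.aemeasurable hV.aemeasurable).1 hind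
  let g : (ℝ × ℝ) × ℝ → ℝ := fun p => p.1.2 * (if p.2 ≤ p.1.1 then (1:ℝ) else 0)
  have hg : Measurable g := by
    refine (measurable_snd.comp measurable_fst).mul ?_
    exact Measurable.ite (measurableSet_le measurable_snd (measurable_fst.comp measurable_fst))
      measurable_const measurable_const
  have hT : Measurable (fun ω => ((Y ω, Z ω), V ω)) := hYZ.prodMk hV
  have h1 : ∫ ω, Z ω * (if V ω ≤ Y ω then (1:ℝ) else 0) ∂P
      = ∫ p, g p ∂(P.map (fun ω => ((Y ω, Z ω), V ω))) := by
    rw [integral_map hT.aemeasurable hg.aestronglyMeasurable]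
  have hgi : Integrable g (P.map (fun ω => ((Y ω, Z ω), V ω))) := by
    rw [integrable_map_measure hg.aestronglyMeasurable hT.aemeasurable]
    refine Integrable.of_bound (hg.comp hT).aestronglyMeasurable 1 (Eventually.of_forall ?_)
    intro ω
    have := hZb ω
    simp only [g, Function.comp, Real.norm_eq_abs]
    split_ifs <;> simp [this]
  have : IsProbabilityMeasure (P.map V) := Measure.isProbabilityMeasure_map hV.aemeasurable
  rw [hmap] at hgi h1
  rw [h1, integral_prod _ hgi,
    integral_map hYZ.aemeasurable hgi.integral_prod_left.aestronglyMeasurable]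
  refine integral_congr_ae (Eventually.of_forall fun ω => ?_)
  simp only [g]
  rw [integral_const_mul, hunif]
  congr 1
  have : (fun y : ℝ => if y ≤ Y ω then (1:ℝ) else 0) = (Set.Iic (Y ω)).indicator (fun _ => 1) := by
    ext y; simp [Set.indicator]
  rw [this, integral_indicator measurableSet_Iic, Measure.restrict_restrict measurableSet_Iic]
  have h2 : Set.Iic (Y ω) ∩ Set.Icc 0 1 = Set.Icc 0 (Y ω) := by
    ext y; have := hY1 ω; simp only [Set.mem_inter_iff, Set.mem_Iic, Set.mem_Icc]
    constructor
    · rintro ⟨a, b, c⟩; exact ⟨b, a⟩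
    · rintro ⟨a, b⟩; exact ⟨b, a, b.trans this⟩
  rw [h2]
  simp [hY0 ω]

theorem lin_aux {Ω : Type*} [m0 : MeasurableSpace Ω] (P : Measure Ω)
    (f a b d e g : Ω → ℝ) (s t : ℝ) (hf : Integrable f P) (ha : Integrable a P)
    (hb : Integrable b P) (hd : Integrable d P) (he : Integrable e P) (hg : Integrable g P) :
    ∫ ω, (f ω + s * (a ω - b ω) + t * (d ω - e ω) + t * g ω) ∂P
      = ∫ ω, f ω ∂P + s * (∫ ω, a ω ∂P - ∫ ω, b ω ∂P) + t * (∫ ω, d ω ∂P - ∫ ω, e ω ∂P)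
        + t * ∫ ω, g ω ∂P := by
  have h1 : Integrable (fun ω => s * (a ω - b ω)) P := (ha.sub hb).const_mul s
  have h2 : Integrable (fun ω => t * (d ω - e ω)) P := (hd.sub he).const_mul t
  have h3 : Integrable (fun ω => t * g ω) P := hg.const_mul t
  have h4 : Integrable (fun ω => f ω + s * (a ω - b ω)) P := hf.add h1
  have h5 : Integrable (fun ω => f ω + s * (a ω - b ω) + t * (d ω - e ω)) P := h4.add h2
  rw [integral_add h5 h3, integral_add h4 h2, integral_add hf h1, integral_const_mul,
    integral_const_mul, integral_const_mul, integral_sub ha hb, integral_sub hd he]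

theorem stmt11
    {Ω : Type*} [m0 : MeasurableSpace Ω]
    (P : Measure Ω) [IsProbabilityMeasure P]
    (U : ℕ → Ω → ℝ) (X : ℕ → Ω → ℝ)
    (hUm : ∀ n, Measurable (U n)) (hXm : ∀ n, Measurable (X n))
    (hX0 : ∀ ω, X 0 ω = 1/2)
    (hrec : ∀ n ω, X (n+1) ω =
      X n ω + (1/((n:ℝ)+3)) * ((if U (n+1) ω ≤ X n ω then (1:ℝ) else 0) - X n ω))
    (hUunif : ∀ n, P.map (U (n+1)) = volume.restrict (Set.Icc (0:ℝ) 1))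
    (hUindep : ∀ n, Indep (MeasurableSpace.comap (U (n+1)) inferInstance)
      (⨆ k ∈ Finset.range (n+1), MeasurableSpace.comap (X k) inferInstance) P)
    (Xinf : Ω → ℝ)
    (hXinf : ∀ᵐ ω ∂P, Tendsto (fun n => X n ω) atTop (nhds (Xinf ω))) :
    (∀ n : ℕ, ∫ ω, (Xinf ω - X n ω)^2 ∂P
      = ∑' j : ℕ, (∫ ω, X (n+j) ω * (1 - X (n+j) ω) ∂P) / ((n:ℝ)+(j:ℝ)+3)^2) ∧
    Tendsto (fun n : ℕ => (n:ℝ) * ∫ ω, (Xinf ω - X n ω)^2 ∂P) atTop (nhds (1/6)) := by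
  have hbd : ∀ n ω, 0 ≤ X n ω ∧ X n ω ≤ 1 := by
    intro n ω
    induction n with
    | zero => rw [hX0]; norm_num
    | succ n ih =>
      obtain ⟨h0, h1⟩ := ih
      rw [hrec]
      have hc0 : 0 ≤ 1/((n:ℝ)+3) := by positivity
      have hc1 : 1/((n:ℝ)+3) ≤ 1 := by
        rw [div_le_one (by positivity)]; linarith [(Nat.cast_nonneg n : (0:ℝ) ≤ n)]
      generalize 1/((n:ℝ)+3) = c at *
      split_ifs <;> constructor <;> nlinarith
  have bddInt : ∀ (Z : Ω → ℝ) (C : ℝ), Measurable Z → (∀ ω, |Z ω| ≤ C) → Integrable Z P := by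
    intro Z C hZ hb
    exact Integrable.of_bound hZ.aestronglyMeasurable C (Eventually.of_forall hb)
  have hIm : ∀ n, Measurable (fun ω => if U (n+1) ω ≤ X n ω then (1:ℝ) else 0) := fun n =>
    Measurable.ite (measurableSet_le (hUm _) (hXm _)) measurable_const measurable_const
  have hkey : ∀ n (Z : Ω → ℝ), 
      Measurable[⨆ k ∈ Finset.range (n+1), MeasurableSpace.comap (X k) inferInstance] Z →
      (∀ ω, |Z ω| ≤ 1) →
      ∫ ω, Z ω * (if U (n+1) ω ≤ X n ω then (1:ℝ) else 0) ∂P = ∫ ω, Z ω * X n ω ∂P := by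
    intro n Z hZ hb
    have hle : (⨆ k ∈ Finset.range (n+1), MeasurableSpace.comap (X k) inferInstance) ≤ m0 :=
      iSup₂_le fun k _ => (hXm k).comap_le
    have hXF : Measurable[⨆ k ∈ Finset.range (n+1), MeasurableSpace.comap (X k) inferInstance]
        (X n) := by
      rw [measurable_iff_comap_le]
      exact le_iSup₂ (f := fun k (_ : k ∈ Finset.range (n+1)) =>
        MeasurableSpace.comap (X k) inferInstance) n (by simp)
    refine key_aux P _ _ _ (hUm _) (hXm n) (hZ.mono hle le_rfl) (fun ω => (hbd n ω).1)
      (fun ω => (hbd n ω).2) hb (hUunif n) ?_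
    rw [IndepFun_iff_Indep]
    refine indep_of_indep_of_le_left (hUindep n).symm ?_
    rw [← measurable_iff_comap_le]
    exact hXF.prodMk hZ
  have hXF : ∀ n k, k ≤ n → Measurable[⨆ k ∈ Finset.range (n+1),
      MeasurableSpace.comap (X k) inferInstance] (X k) := by
    intro n k hk
    rw [measurable_iff_comap_le]
    exact le_iSup₂ (f := fun k (_ : k ∈ Finset.range (n+1)) =>
        MeasurableSpace.comap (X k) inferInstance) k (by simp; omega)
  have hstep : ∀ m n, n ≤ m → ∫ ω, (X (m+1) ω - X n ω)^2 ∂P =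
      ∫ ω, (X m ω - X n ω)^2 ∂P + (∫ ω, X m ω * (1 - X m ω) ∂P) / ((m:ℝ)+3)^2 := by
    intro m n hnm
    have e1 := hkey m (fun ω => X m ω - X n ω) ((hXF m m le_rfl).sub (hXF m n hnm)) (by
      intro ω; rw [abs_le]; constructor <;> linarith [(hbd m ω).1, (hbd m ω).2, (hbd n ω).1, (hbd n ω).2])
    have e2 := hkey m (fun ω => 1 - 2 * X m ω) (measurable_const.sub ((hXF m m le_rfl).const_mul 2)) (by
      intro ω; rw [abs_le]; constructor <;> linarith [(hbd m ω).1, (hbd m ω).2])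
    have b : ∀ n ω, |X n ω| ≤ 1 := fun n ω => abs_le.2 ⟨by linarith [(hbd n ω).1], (hbd n ω).2⟩
    have bI : ∀ n ω, |(if U (n+1) ω ≤ X n ω then (1:ℝ) else 0)| ≤ 1 := by
      intro n ω; split_ifs <;> simp
    have b1 : ∀ ω, |X m ω - X n ω| ≤ 1 := by
      intro ω; rw [abs_le]; constructor <;> linarith [(hbd m ω).1, (hbd m ω).2, (hbd n ω).1, (hbd n ω).2]
    have b2 : ∀ ω, |1 - 2 * X m ω| ≤ 1 := by
      intro ω; rw [abs_le]; constructor <;> linarith [(hbd m ω).1, (hbd m ω).2]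
    have hmul : ∀ (f g : Ω → ℝ), Measurable f → Measurable g → (∀ ω, |f ω| ≤ 1) →
        (∀ ω, |g ω| ≤ 1) → Integrable (fun ω => f ω * g ω) P := by
      intro f g hf hg hf1 hg1
      refine bddInt _ 1 (hf.mul hg) fun ω => ?_
      rw [abs_mul]; exact mul_le_one₀ (hf1 ω) (abs_nonneg _) (hg1 ω)
    have mD : Measurable (fun ω => X m ω - X n ω) := (hXm m).sub (hXm n)
    have mE : Measurable (fun ω => 1 - 2 * X m ω) := measurable_const.sub ((hXm m).const_mul 2)
    have i1 := hmul _ _ mD (hIm m) b1 (bI m)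
    have i2 := hmul _ _ mD (hXm m) b1 (b m)
    have i3 := hmul _ _ mE (hIm m) b2 (bI m)
    have i4 := hmul _ _ mE (hXm m) b2 (b m)
    have i5 := hmul _ _ mD mD b1 b1
    have i6 : Integrable (fun ω => X m ω * (1 - X m ω)) P := by
      refine hmul _ _ (hXm m) (measurable_const.sub (hXm m)) (b m) fun ω => ?_
      rw [abs_le]; constructor <;> linarith [(hbd m ω).1, (hbd m ω).2]
    set c : ℝ := 1/((m:ℝ)+3) with hc
    have hpt : ∀ ω, (X (m+1) ω - X n ω)^2 =
        (X m ω - X n ω) * (X m ω - X n ω)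
        + 2 * c * ((X m ω - X n ω) * (if U (m+1) ω ≤ X m ω then (1:ℝ) else 0)
          - (X m ω - X n ω) * X m ω)
        + c^2 * ((1 - 2 * X m ω) * (if U (m+1) ω ≤ X m ω then (1:ℝ) else 0)
          - (1 - 2 * X m ω) * X m ω)
        + c^2 * (X m ω * (1 - X m ω)) := by
      intro ω
      rw [hrec, ← hc]
      split_ifs <;> ring
    simp_rw [hpt]
    rw [lin_aux P _ _ _ _ _ _ (2*c) (c^2) i5 i1 i2 i3 i4 i6, e1, e2]
    simp_rw [← pow_two]
    rw [hc]; field_simp; ring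
  have hv : ∀ n j, ∫ ω, (X (n+j) ω - X n ω)^2 ∂P =
      ∑ i ∈ Finset.range j, (∫ ω, X (n+i) ω * (1 - X (n+i) ω) ∂P) / ((n:ℝ)+(i:ℝ)+3)^2 := by
    intro n j
    induction j with
    | zero => simp
    | succ j ih =>
      rw [Finset.sum_range_succ, ← ih, ← add_assoc, hstep _ _ (Nat.le_add_right n j)]
      push_cast; rfl
  have ha' : ∀ n, ∫ ω, X n ω * (1 - X n ω) ∂P = 1/4 - ∫ ω, (X n ω - X 0 ω)^2 ∂P := by
    intro n
    have hp : ∀ ω, X n ω * (1 - X n ω) = 1/4 - (X n ω - X 0 ω)^2 := by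
      intro ω; rw [hX0]; ring
    simp_rw [hp]
    rw [integral_sub (integrable_const _)]
    · simp
    · refine bddInt _ 1 (((hXm n).sub (hXm 0)).pow_const 2) fun ω => ?_
      rw [abs_of_nonneg (sq_nonneg _), hX0]
      nlinarith [(hbd n ω).1, (hbd n ω).2]
  have ha : ∀ n, ∫ ω, X n ω * (1 - X n ω) ∂P = ((n:ℝ)+3)/(6*((n:ℝ)+2)) := by
    intro n
    induction n with
    | zero => simp [hX0]; norm_num
    | succ n ih =>
      rw [ha', hstep n 0 (Nat.zero_le _), ih]
      have h := ha' n
      rw [ih] at h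
      have h' : ∫ ω, (X n ω - X 0 ω)^2 ∂P = 1/4 - ((n:ℝ)+3)/(6*((n:ℝ)+2)) := by linarith
      rw [h']
      push_cast
      have : (n:ℝ)+1+2 = n+3 := by ring
      rw [this]
      field_simp
      ring
  have hlim : ∀ n, Tendsto (fun j => ∫ ω, (X (n+j) ω - X n ω)^2 ∂P) atTop
      (nhds (∫ ω, (Xinf ω - X n ω)^2 ∂P)) := by
    intro n
    refine tendsto_integral_of_dominated_convergence (fun _ => (1:ℝ)) (fun j =>
      (((hXm _).sub (hXm n)).pow_const 2).aestronglyMeasurable) (integrable_const _) ?_ ?_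
    · refine fun j => Eventually.of_forall fun ω => ?_
      rw [Real.norm_eq_abs, abs_of_nonneg (sq_nonneg _), sq_le_one_iff_abs_le_one, abs_le]
      constructor <;> linarith [(hbd n ω).1, (hbd n ω).2, (hbd (n+j) ω).1, (hbd (n+j) ω).2]
    · filter_upwards [hXinf] with ω hω
      have h1 : Tendsto (fun j => X (n+j) ω) atTop (nhds (Xinf ω)) := by
        simp_rw [add_comm n]
        exact (tendsto_add_atTop_iff_nat n).2 hω
      exact (h1.sub_const _).pow 2
  have hsum : ∀ n, HasSum (fun j : ℕ =>
      (∫ ω, X (n+j) ω * (1 - X (n+j) ω) ∂P) / ((n:ℝ)+(j:ℝ)+3)^2)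
      (∫ ω, (Xinf ω - X n ω)^2 ∂P) := by
    intro n
    rw [hasSum_iff_tendsto_nat_of_nonneg]
    · simp_rw [← hv]; exact hlim n
    · intro j; rw [ha]; positivity
  have hval : ∀ n : ℕ, ∫ ω, (Xinf ω - X n ω)^2 ∂P = 1/(6*((n:ℝ)+2)) := by
    intro n
    refine tendsto_nhds_unique (hlim n) ?_
    have hcl : ∀ j : ℕ, ∫ ω, (X (n+j) ω - X n ω)^2 ∂P
        = 1/(6*((n:ℝ)+2)) - 1/6 * (1/(((j + (n+1) : ℕ):ℝ)+1)) := by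
      intro j
      rw [hv]
      induction j with
      | zero => simp; field_simp; ring
      | succ j ih =>
        rw [Finset.sum_range_succ, ih, ha]
        push_cast
        have e1 : (j:ℝ)+(n+1)+1 = n+j+2 := by ring
        have e2 : (j:ℝ)+1+(n+1)+1 = n+j+3 := by ring
        rw [e1, e2]
        field_simp
        ring
    simp_rw [hcl]
    have h0 := (tendsto_add_atTop_iff_nat (n+1)).2
      (tendsto_one_div_add_atTop_nhds_zero_nat (𝕜 := ℝ))
    have h1 := (h0.const_mul (1/6)).const_sub (1/(6*((n:ℝ)+2)))
    rw [mul_zero, sub_zero] at h1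
    exact h1
  refine ⟨fun n => (hsum n).tsum_eq.symm, ?_⟩
  simp_rw [hval]
  have h0 := (tendsto_add_atTop_iff_nat 1).2 (tendsto_one_div_add_atTop_nhds_zero_nat (𝕜 := ℝ))
  have h1 := (h0.const_mul (1/3)).const_sub (1/6)
  simp only [mul_zero, sub_zero] at h1
  refine h1.congr fun n => ?_
  push_cast
  have : (n:ℝ)+1+1 = n+2 := by ring
  rw [this]
  field_simp
  ring
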